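/- Let L be a natural number and let A, Z_X^(0), …, Z_X^(L), Z_A^(0), …, Z_A^(L), Z_H^(0), …, Z_H^(L) be random variables with finite range on a probability space (Ω, 𝓕, μ), ordered as A, Z_X^(0), Z_A^(0), Z_H^(0), Z_X^(1), Z_A^(1), Z_H^(1), …, Z_X^(L), Z_A^(L), Z_H^(L), and satisfying the Markovian dependence conditions: for every l ∈ {0, …, L}, (i) I[Z_A^(l) : P_l | (A, Z_X^(l))] = 0, where P_l denotes the tuple of all variables preceding Z_A^(l) in the ordering; (ii) I[Z_H^(l) : Q_l | (Z_A^(l), Z_X^(l))] = 0, where Q_l denotes the tuple of all variables preceding Z_H^(l) in the ordering; and (iii) if l < L, I[Z_X^(l+1) : R_l | (Z_H^(l), Z_A^(l))] = 0, where R_l denotes the tuple of all variables preceding Z_X^(l+1) in the ordering. Set 𝒟_s = (A, Z_X^(0)). Let S_H be a nonempty subset of {0, 1, …, L} and S_A = {max(S_H), max(S_H)+1, …, L}. For each l ∈ S_A let q_A^(l) be a strictly positive probability mass function on range(Z_A^(l)), and for each l ∈ S_H let q_H^(l) be a strictly positive probability mass function on range(Z_H^(l)). For values a, x, z in the respective ranges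 with P(A = a, Z_X^(l) = x) > 0, write p_A^(l)(z | a, x) = P(Z_A^(l) = z, A = a, Z_X^(l) = x)/P(A = a, Z_X^(l) = x), and define p_H^(l)(z | z_a, x) analogously as the conditional probability mass function of Z_H^(l) given (Z_A^(l), Z_X^(l)). Then I[𝒟_s : Z_H^(L) ; μ] ≤ Σ_{l ∈ S_A} E_μ[ log( p_A^(l)(Z_A^(l) | A, Z_X^(l)) / q_A^(l)(Z_A^(l)) ) ] + Σ_{l ∈ S_H} E_μ[ log( p_H^(l)(Z_H^(l) | Z_A^(l), Z_X^(l)) / q_H^(l)(Z_H^(l)) ) ]. -/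

import Mathlib

open MeasureTheory

/-- Shannon entropy `H[X ; μ]` of a random variable `X` with finite range,
`H[X] = ∑ s, -P(X = s) log P(X = s)`. -/
noncomputable def finEntropy {Ω S : Type*} [MeasurableSpace Ω] [Fintype S]
    (μ : Measure Ω) (X : Ω → S) : ℝ :=
  ∑ s : S, Real.negMulLog ((μ (X ⁻¹' {s})).toReal)

/-- Mutual information `I[X : Y ; μ] = H[X] + H[Y] - H[(X, Y)]` for random variables
with finite range. -/
noncomputable def finMutualInfo {Ω S T : Type*} [MeasurableSpace Ω] [Fintype S] [Fintype T]
    (μ : Measure Ω) (X : Ω → S) (Y : Ω → T) : ℝ :=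
  finEntropy μ X + finEntropy μ Y - finEntropy μ (fun ω => (X ω, Y ω))

/-- Conditional mutual information
`I[X : Y | Z ; μ] = H[(X, Z)] + H[(Y, Z)] - H[(X, Y, Z)] - H[Z]` for random
variables with finite range. -/
noncomputable def finCondMutualInfo {Ω S T U : Type*} [MeasurableSpace Ω]
    [Fintype S] [Fintype T] [Fintype U]
    (μ : Measure Ω) (X : Ω → S) (Y : Ω → T) (Z : Ω → U) : ℝ :=
  finEntropy μ (fun ω => (X ω, Z ω)) + finEntropy μ (fun ω => (Y ω, Z ω))
    - finEntropy μ (fun ω => (X ω, Y ω, Z ω)) - finEntropy μ Z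

/-- The ordered sequence of the `3 * L + 4` random variables
`A, Z_X⁽⁰⁾, Z_A⁽⁰⁾, Z_H⁽⁰⁾, Z_X⁽¹⁾, Z_A⁽¹⁾, Z_H⁽¹⁾, …, Z_X⁽ᴸ⁾, Z_A⁽ᴸ⁾, Z_H⁽ᴸ⁾`. -/
def mlVars {Ω S : Type*} (L : ℕ) (A : Ω → S) (ZX ZA ZH : Fin (L + 1) → Ω → S)
    (i : Fin (3 * L + 4)) : Ω → S :=
  if _ : i.val = 0 then A
  else if _ : (i.val - 1) % 3 = 0 then ZX ⟨(i.val - 1) / 3, by omega⟩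
  else if _ : (i.val - 1) % 3 = 1 then ZA ⟨(i.val - 1) / 3, by omega⟩
  else ZH ⟨(i.val - 1) / 3, by omega⟩

/-- The tuple of the first `k` variables of the ordered sequence `mlVars`, viewed as
a single random variable with finite range `Fin k → S`. -/
def mlPrefix {Ω S : Type*} (L : ℕ) (A : Ω → S) (ZX ZA ZH : Fin (L + 1) → Ω → S)
    (k : ℕ) (hk : k ≤ 3 * L + 4) : Ω → (Fin k → S) :=
  fun ω i => mlVars L A ZX ZA ZH (Fin.castLE hk i) ω

/-- The conditional probability mass function `P(Z = z ∣ W = w)`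
(with junk value `0` when `P(W = w) = 0`). -/
noncomputable def finCondPMF {Ω S T : Type*} [MeasurableSpace Ω]
    (μ : Measure Ω) (Z : Ω → S) (W : Ω → T) (z : S) (w : T) : ℝ :=
  (μ {ω | Z ω = z ∧ W ω = w}).toReal / (μ {ω | W ω = w}).toReal

lemma sum_measureReal_fiber_prod {Ω S U : Type*} [MeasurableSpace Ω] [Fintype S]
    [MeasurableSpace S] [MeasurableSingletonClass S] {μ : Measure Ω} [IsFiniteMeasure μ]
    {X : Ω → S} (hX : Measurable X) (Z : Ω → U) (z : U) :
    ∑ x, μ.real ((fun ω => (X ω, Z ω)) ⁻¹' {(x, z)}) = μ.real (Z ⁻¹' {z}) := by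
  have h := sum_measureReal_preimage_singleton (μ := μ.restrict (Z ⁻¹' {z})) Finset.univ
    fun x _ => hX (measurableSet_singleton x)
  simp only [Finset.coe_univ, Set.preimage_univ, measureReal_restrict_apply_univ] at h
  rw [← h]
  refine Finset.sum_congr rfl fun x _ => ?_
  rw [measureReal_restrict_apply (hX (measurableSet_singleton x))]
  congr 1
  ext ω
  simp

lemma integral_add_sub_of_integrable {Ω : Type*} [MeasurableSpace Ω] {μ : Measure Ω}
    {f g h : Ω → ℝ} (hf : Integrable f μ) (hg : Integrable g μ) (hh : Integrable h μ) :
    ∫ ω, (f ω + g ω - h ω) ∂μ = ∫ ω, f ω ∂μ + ∫ ω, g ω ∂μ - ∫ ω, h ω ∂μ := by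
  rw [integral_sub (f := fun ω => f ω + g ω) (hf.add hg) hh, integral_add hf hg]

section FiniteEntropy

variable {Ω S T U V : Type*} [MeasurableSpace Ω]
  [Fintype S] [MeasurableSpace S] [MeasurableSingletonClass S]
  [Fintype T] [MeasurableSpace T] [MeasurableSingletonClass T]
  [Fintype U] [MeasurableSpace U] [MeasurableSingletonClass U]
  [Fintype V] [MeasurableSpace V] [MeasurableSingletonClass V]
  {μ : Measure Ω}

lemma integrable_comp_of_fintype [IsFiniteMeasure μ] {X : Ω → T} (hX : Measurable X)
    (f : T → ℝ) : Integrable (fun ω => f (X ω)) μ :=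
  (Integrable.of_finite (μ := μ.map X) (f := f)).comp_measurable hX

lemma integral_comp_eq_sum [IsFiniteMeasure μ] {X : Ω → T} (hX : Measurable X) (f : T → ℝ) :
    ∫ ω, f (X ω) ∂μ = ∑ t, μ.real (X ⁻¹' {t}) * f t := by
  rw [← integral_map hX.aemeasurable (measurable_of_finite f).aestronglyMeasurable,
    integral_fintype Integrable.of_finite]
  simp [map_measureReal_apply hX]

lemma ae_measureReal_fiber_pos [IsFiniteMeasure μ] {X : Ω → T} (hX : Measurable X) :
    ∀ᵐ ω ∂μ, 0 < μ.real (X ⁻¹' {X ω}) := by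
  refine ae_of_ae_map (p := fun t => 0 < μ.real (X ⁻¹' {t})) hX.aemeasurable ?_
  rw [ae_iff_of_countable]
  intro t ht
  rw [Measure.map_apply hX (measurableSet_singleton t)] at ht
  exact measureReal_nonneg.lt_of_ne' ((measureReal_ne_zero_iff).2 ht)

lemma finEntropy_eq_integral [IsFiniteMeasure μ] {X : Ω → T} (hX : Measurable X) :
    finEntropy μ X = ∫ ω, -Real.log (μ.real (X ⁻¹' {X ω})) ∂μ := by
  rw [integral_comp_eq_sum hX (fun t => -Real.log (μ.real (X ⁻¹' {t})))]
  refine Finset.sum_congr rfl fun t _ => ?_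
  simp [Real.negMulLog, Measure.real]

lemma finEntropy_congr [IsFiniteMeasure μ] {X : Ω → T} {Y : Ω → U}
    (hX : Measurable X) (hY : Measurable Y) (h : ∀ ω ω', X ω = X ω' ↔ Y ω = Y ω') :
    finEntropy μ X = finEntropy μ Y := by
  rw [finEntropy_eq_integral hX, finEntropy_eq_integral hY]
  congr with ω
  congr 3
  ext η
  exact h η ω

/-- The Gibbs inequality. -/
lemma finEntropy_le_integral_neg_log [IsProbabilityMeasure μ] {X : Ω → T} (hX : Measurable X)
    {r : T → ℝ} (hr : ∀ t, 0 ≤ r t) (hsum : ∑ t, r t ≤ 1)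
    (hpos : ∀ t, 0 < μ.real (X ⁻¹' {t}) → 0 < r t) :
    finEntropy μ X ≤ ∫ ω, -Real.log (r (X ω)) ∂μ := by
  have hp : ∑ t, μ.real (X ⁻¹' {t}) = 1 := by
    rw [sum_measureReal_preimage_singleton _ fun t _ => hX (measurableSet_singleton t)]
    simp
  rw [finEntropy_eq_integral hX, integral_comp_eq_sum hX (fun t => -Real.log (r t)),
    integral_comp_eq_sum hX (fun t => -Real.log (μ.real (X ⁻¹' {t}))), ← sub_nonpos,
    ← Finset.sum_sub_distrib]
  refine le_trans (b := ∑ t, (r t - μ.real (X ⁻¹' {t}))) (Finset.sum_le_sum fun t _ => ?_) ?_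
  · rcases (measureReal_nonneg (μ := μ) (s := X ⁻¹' {t})).eq_or_lt with h | h
    · simpa [← h] using hr t
    · have hlog := Real.log_le_sub_one_of_pos (div_pos (hpos t h) h)
      rw [Real.log_div (hpos t h).ne' h.ne'] at hlog
      have := mul_le_mul_of_nonneg_left hlog h.le
      rw [mul_sub, mul_sub, mul_div_cancel₀ _ h.ne'] at this
      linarith
  · rw [Finset.sum_sub_distrib, hp]
    linarith

lemma finCondMutualInfo_nonneg [IsProbabilityMeasure μ] {X : Ω → S} {Y : Ω → T} {Z : Ω → U}
    (hX : Measurable X) (hY : Measurable Y) (hZ : Measurable Z) :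
    0 ≤ finCondMutualInfo μ X Y Z := by
  set a : S × U → ℝ := fun t => μ.real ((fun ω => (X ω, Z ω)) ⁻¹' {t})
  set b : T × U → ℝ := fun t => μ.real ((fun ω => (Y ω, Z ω)) ⁻¹' {t})
  set c : U → ℝ := fun t => μ.real (Z ⁻¹' {t})
  have hXZ := hX.prodMk hZ
  have hYZ := hY.prodMk hZ
  have gibbs := finEntropy_le_integral_neg_log (μ := μ) (hX.prodMk hYZ)
    (r := fun t => a (t.1, t.2.2) * b t.2 / c t.2.2)
    (fun t => div_nonneg (mul_nonneg measureReal_nonneg measureReal_nonneg) measureReal_nonneg)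
    ?_ ?_
  · have hint : ∫ ω, -Real.log (a (X ω, Z ω) * b (Y ω, Z ω) / c (Z ω)) ∂μ
        = finEntropy μ (fun ω => (X ω, Z ω)) + finEntropy μ (fun ω => (Y ω, Z ω))
          - finEntropy μ Z := by
      rw [finEntropy_eq_integral hXZ, finEntropy_eq_integral hYZ, finEntropy_eq_integral hZ,
        ← integral_add_sub_of_integrable
          (integrable_comp_of_fintype hXZ fun t => -Real.log (a t))
          (integrable_comp_of_fintype hYZ fun t => -Real.log (b t))
          (integrable_comp_of_fintype hZ fun t => -Real.log (c t))]
      refine integral_congr_ae ?_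
      filter_upwards [ae_measureReal_fiber_pos hXZ, ae_measureReal_fiber_pos hYZ,
        ae_measureReal_fiber_pos hZ] with ω h1 h2 h3
      have h1' : a (X ω, Z ω) ≠ 0 := h1.ne'
      have h2' : b (Y ω, Z ω) ≠ 0 := h2.ne'
      have h3' : c (Z ω) ≠ 0 := h3.ne'
      change _ = -Real.log (a (X ω, Z ω)) + -Real.log (b (Y ω, Z ω)) - -Real.log (c (Z ω))
      rw [Real.log_div (mul_ne_zero h1' h2') h3', Real.log_mul h1' h2']
      ring
    rw [finCondMutualInfo]
    linarith [gibbs.trans_eq hint]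
  · have hza : ∀ z, ∑ x, a (x, z) = c z := sum_measureReal_fiber_prod hX Z
    have hzb : ∀ z, ∑ y, b (y, z) = c z := sum_measureReal_fiber_prod hY Z
    have hzc : ∑ z, c z = 1 := by
      rw [sum_measureReal_preimage_singleton _ fun t _ => hZ (measurableSet_singleton t)]
      simp
    rw [Fintype.sum_prod_type, Finset.sum_comm, Fintype.sum_prod_type_right]
    simp only [← Finset.sum_div, ← Finset.sum_mul, hza, ← Finset.mul_sum, hzb]
    simp [mul_self_div_self, hzc]
  · rintro ⟨x, y, z⟩ h
    have mono {s t : Set Ω} (hst : s ⊆ t) (hs : 0 < μ.real s) : 0 < μ.real t :=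
      hs.trans_le (measureReal_mono hst)
    refine div_pos (mul_pos (mono ?_ h) (mono ?_ h)) (mono ?_ h)
    all_goals
      intro ω
      simp only [Set.mem_preimage, Set.mem_singleton_iff, Prod.mk.injEq]
      tauto

lemma finEntropy_submodular [IsProbabilityMeasure μ] {X : Ω → S} {Y : Ω → T} {Z : Ω → U}
    (hX : Measurable X) (hY : Measurable Y) (hZ : Measurable Z) :
    finEntropy μ (fun ω => (X ω, Y ω, Z ω)) + finEntropy μ Z
      ≤ finEntropy μ (fun ω => (X ω, Z ω)) + finEntropy μ (fun ω => (Y ω, Z ω)) := by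
  have := finCondMutualInfo_nonneg (μ := μ) hX hY hZ
  rw [finCondMutualInfo] at this
  linarith

lemma finMutualInfo_nonneg [IsProbabilityMeasure μ] {X : Ω → S} {Y : Ω → T}
    (hX : Measurable X) (hY : Measurable Y) : 0 ≤ finMutualInfo μ X Y := by
  have hc : Measurable fun _ : Ω => () := measurable_const
  have h := finEntropy_submodular (μ := μ) hX hY hc
  have h0 : finEntropy μ (fun _ : Ω => ()) = 0 := by simp [finEntropy]
  rw [h0, finEntropy_congr (hX.prodMk hc) hX (by simp),
    finEntropy_congr (hY.prodMk hc) hY (by simp),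
    finEntropy_congr (hX.prodMk (hY.prodMk hc)) (hX.prodMk hY) (by simp)] at h
  rw [finMutualInfo]
  linarith

lemma finCondMutualInfo_comp_eq_zero [IsProbabilityMeasure μ] {X : Ω → S} {Y : Ω → T} {Z : Ω → U}
    (hX : Measurable X) (hY : Measurable Y) (hZ : Measurable Z) (g : T → V)
    (h : finCondMutualInfo μ X Y Z = 0) : finCondMutualInfo μ X (fun ω => g (Y ω)) Z = 0 := by
  have hgY : Measurable fun ω => g (Y ω) := (measurable_of_finite g).comp hY
  refine le_antisymm ?_ (finCondMutualInfo_nonneg hX hgY hZ)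
  have hs := finEntropy_submodular (μ := μ) hX hY (hgY.prodMk hZ)
  rw [finEntropy_congr (hX.prodMk (hY.prodMk (hgY.prodMk hZ))) (hX.prodMk (hY.prodMk hZ))
      (by grind),
    finEntropy_congr (hY.prodMk (hgY.prodMk hZ)) (hY.prodMk hZ) (by grind)] at hs
  rw [finCondMutualInfo] at h ⊢
  linarith

lemma finMutualInfo_le_integral_log_condPMF_div [IsProbabilityMeasure μ]
    {Z : Ω → S} {W : Ω → T} (hZ : Measurable Z) (hW : Measurable W) {q : S → ℝ}
    (hq : ∀ s, 0 < q s) (hsum : ∑ s, q s = 1) :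
    finMutualInfo μ Z W ≤ ∫ ω, Real.log (finCondPMF μ Z W (Z ω) (W ω) / q (Z ω)) ∂μ := by
  have hZW := hZ.prodMk hW
  have gibbs := finEntropy_le_integral_neg_log (μ := μ) hZ (fun s => (hq s).le) hsum.le
    fun s _ => hq s
  have hint : ∫ ω, Real.log (finCondPMF μ Z W (Z ω) (W ω) / q (Z ω)) ∂μ
      = ∫ ω, -Real.log (q (Z ω)) ∂μ + finEntropy μ W - finEntropy μ (fun ω => (Z ω, W ω)) := by
    have iq := integrable_comp_of_fintype (μ := μ) hZ fun s => -Real.log (q s)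
    have iW := integrable_comp_of_fintype (μ := μ) hW fun t => -Real.log (μ.real (W ⁻¹' {t}))
    have iZW := integrable_comp_of_fintype (μ := μ) hZW
      fun t => -Real.log (μ.real ((fun ω => (Z ω, W ω)) ⁻¹' {t}))
    rw [finEntropy_eq_integral hW, finEntropy_eq_integral hZW,
      ← integral_add_sub_of_integrable iq iW iZW]
    refine integral_congr_ae ?_
    filter_upwards [ae_measureReal_fiber_pos hZW, ae_measureReal_fiber_pos hW] with ω h1 h2
    have hpmf : finCondPMF μ Z W (Z ω) (W ω)
        = μ.real ((fun ω => (Z ω, W ω)) ⁻¹' {(Z ω, W ω)}) / μ.real (W ⁻¹' {W ω}) := by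
      have hset : {ω' | Z ω' = Z ω ∧ W ω' = W ω}
          = (fun ω => (Z ω, W ω)) ⁻¹' {(Z ω, W ω)} := by ext; simp
      rw [finCondPMF, hset]
      rfl
    rw [hpmf, Real.log_div (div_pos h1 h2).ne' (hq _).ne', Real.log_div h1.ne' h2.ne']
    ring
  rw [finMutualInfo, hint]
  linarith

lemma finMutualInfo_le_prodMk [IsProbabilityMeasure μ] {D : Ω → T} {H : Ω → S} {Z : Ω → U}
    (hD : Measurable D) (hH : Measurable H) (hZ : Measurable Z) :
    finMutualInfo μ D H ≤ finMutualInfo μ D (fun ω => (H ω, Z ω)) := by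
  have h := finEntropy_submodular (μ := μ) hD hZ hH
  rw [finEntropy_congr (hZ.prodMk hH) (hH.prodMk hZ) (by grind),
    finEntropy_congr (hD.prodMk (hZ.prodMk hH)) (hD.prodMk (hH.prodMk hZ)) (by grind)] at h
  simp only [finMutualInfo]
  linarith

/-- Data processing for one layer whose representation `Z` depends on the source `(a, x₀)` only
through `(a, x)`, and whose representation `H` depends on it only through `(Z, x)`. -/
lemma finMutualInfo_le_add_of_markov [IsProbabilityMeasure μ] {a x₀ x Z H : Ω → S}
    (ha : Measurable a) (hx₀ : Measurable x₀) (hx : Measurable x) (hZ : Measurable Z)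
    (hH : Measurable H)
    (hZD : finCondMutualInfo μ Z (fun ω => (a ω, x₀ ω)) (fun ω => (a ω, x ω)) = 0)
    (hHD : finCondMutualInfo μ H (fun ω => (a ω, x₀ ω)) (fun ω => (Z ω, x ω)) = 0) :
    finMutualInfo μ (fun ω => (a ω, x₀ ω)) (fun ω => (H ω, Z ω))
      ≤ finMutualInfo μ Z (fun ω => (a ω, x ω)) + finMutualInfo μ H (fun ω => (Z ω, x ω)) := by
  have hD := ha.prodMk hx₀
  have hax := ha.prodMk hx
  have hZx := hZ.prodMk hx
  have s₁ := finEntropy_submodular (μ := μ) hx hZ hD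
  have s₂ := finMutualInfo_nonneg (μ := μ) hZ hH
  have s₃ := finEntropy_submodular (μ := μ) hx hH (hD.prodMk hZ)
  simp only [finCondMutualInfo, finMutualInfo] at hZD hHD s₂ ⊢
  rw [finEntropy_congr (hD.prodMk hax) (hx.prodMk hD) (by grind),
    finEntropy_congr (hZ.prodMk (hD.prodMk hax)) (hx.prodMk (hZ.prodMk hD)) (by grind)] at hZD
  rw [finEntropy_congr (hD.prodMk hZx) (hx.prodMk (hZ.prodMk hD)) (by grind)] at hHD
  rw [finEntropy_congr (hx.prodMk (hD.prodMk hZ)) (hx.prodMk (hZ.prodMk hD)) (by grind),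
    finEntropy_congr (hx.prodMk (hH.prodMk (hD.prodMk hZ))) (hH.prodMk (hD.prodMk hZx))
      (by grind),
    finEntropy_congr (hD.prodMk hZ) (hZ.prodMk hD) (by grind),
    finEntropy_congr (hH.prodMk (hD.prodMk hZ)) (hD.prodMk (hH.prodMk hZ)) (by grind)] at s₃
  rw [finEntropy_congr (hZ.prodMk hH) (hH.prodMk hZ) (by grind)] at s₂
  linarith

/-- One layer of a Markovian hierarchy increases the information about the source `(a, x₀)` by at
most the mutual information between its representation of `a` and its inputs. -/
lemma finMutualInfo_succ_le_of_markov [IsProbabilityMeasure μ] {a x₀ Z H x' Z' H' : Ω → S}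
    (ha : Measurable a) (hx₀ : Measurable x₀) (hZ : Measurable Z) (hH : Measurable H)
    (hx' : Measurable x') (hZ' : Measurable Z') (hH' : Measurable H')
    (hxD : finCondMutualInfo μ x' (fun ω => (a ω, x₀ ω)) (fun ω => (H ω, Z ω)) = 0)
    (hZD : finCondMutualInfo μ Z' (fun ω => (a ω, x₀ ω)) (fun ω => (a ω, x' ω)) = 0)
    (hHD : finCondMutualInfo μ H' (fun ω => (a ω, x₀ ω)) (fun ω => (Z' ω, x' ω)) = 0) :
    finMutualInfo μ (fun ω => (a ω, x₀ ω)) (fun ω => (H' ω, Z' ω))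
      ≤ finMutualInfo μ (fun ω => (a ω, x₀ ω)) (fun ω => (H ω, Z ω))
        + finMutualInfo μ Z' (fun ω => (a ω, x' ω)) := by
  have hD := ha.prodMk hx₀
  have hax := ha.prodMk hx'
  have hZx := hZ'.prodMk hx'
  have hHZ := hH.prodMk hZ
  have hHZ' := hH'.prodMk hZ'
  have s₁ := finEntropy_submodular (μ := μ) hD hx' hHZ'
  have s₂ := finMutualInfo_nonneg (μ := μ) hZ' hx'
  have s₃ := finEntropy_submodular (μ := μ) hD hHZ hx'
  simp only [finCondMutualInfo, finMutualInfo] at hxD hZD hHD s₂ ⊢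
  rw [finEntropy_congr (hD.prodMk hax) (hD.prodMk hx') (by grind),
    finEntropy_congr (hZ'.prodMk (hD.prodMk hax)) (hD.prodMk hZx) (by grind)] at hZD
  rw [finEntropy_congr (hD.prodMk (hx'.prodMk hHZ')) (hH'.prodMk (hD.prodMk hZx)) (by grind),
    finEntropy_congr (hx'.prodMk hHZ') (hH'.prodMk hZx) (by grind)] at s₁
  rw [finEntropy_congr (hD.prodMk (hHZ.prodMk hx')) (hx'.prodMk (hD.prodMk hHZ)) (by grind),
    finEntropy_congr (hHZ.prodMk hx') (hx'.prodMk hHZ) (by grind)] at s₃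
  linarith

end FiniteEntropy

lemma measurable_mlPrefix {Ω S : Type*} [MeasurableSpace Ω] [MeasurableSpace S] {L : ℕ}
    {A : Ω → S} {ZX ZA ZH : Fin (L + 1) → Ω → S}
    (hA : Measurable A) (hZX : ∀ l, Measurable (ZX l))
    (hZA : ∀ l, Measurable (ZA l)) (hZH : ∀ l, Measurable (ZH l)) (k : ℕ) (hk : k ≤ 3 * L + 4) :
    Measurable (mlPrefix L A ZX ZA ZH k hk) := by
  refine measurable_pi_lambda _ fun i => ?_
  change Measurable (mlVars L A ZX ZA ZH (Fin.castLE hk i))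
  unfold mlVars
  split_ifs <;> simp only [*]

lemma finCondMutualInfo_source_eq_zero {Ω S U : Type*} [MeasurableSpace Ω]
    [Fintype S] [MeasurableSpace S] [MeasurableSingletonClass S]
    [Fintype U] [MeasurableSpace U] [MeasurableSingletonClass U]
    {μ : Measure Ω} [IsProbabilityMeasure μ] {L : ℕ}
    {A : Ω → S} {ZX ZA ZH : Fin (L + 1) → Ω → S}
    (hA : Measurable A) (hZX : ∀ l, Measurable (ZX l))
    (hZA : ∀ l, Measurable (ZA l)) (hZH : ∀ l, Measurable (ZH l)) {X : Ω → S} {Z : Ω → U}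
    (hX : Measurable X) (hZ : Measurable Z) {k : ℕ} {hk : k ≤ 3 * L + 4} (hk2 : 2 ≤ k)
    (h : finCondMutualInfo μ X (mlPrefix L A ZX ZA ZH k hk) Z = 0) :
    finCondMutualInfo μ X (fun ω => (A ω, ZX 0 ω)) Z = 0 := by
  have hcomp := finCondMutualInfo_comp_eq_zero hX (measurable_mlPrefix hA hZX hZA hZH k hk) hZ
    (fun p => (p ⟨0, by omega⟩, p ⟨1, by omega⟩)) h
  simpa [mlPrefix, mlVars] using hcomp

/-- Proposition 2 of the paper, full variational form: under the Markovian
dependence space 𝓜, for any nonempty `S_H ⊆ {0, …, L}`, `S_A = {max S_H, …, L}`,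
and strictly positive variational pmfs `q_A⁽ˡ⁾` (for `l ∈ S_A`) and `q_H⁽ˡ⁾`
(for `l ∈ S_H`), the information `I[𝒟_s : Z_H⁽ᴸ⁾]` is bounded by
`∑_{l ∈ S_A} E_μ[log (p_A⁽ˡ⁾(Z_A⁽ˡ⁾ ∣ A, Z_X⁽ˡ⁾) / q_A⁽ˡ⁾(Z_A⁽ˡ⁾))]
 + ∑_{l ∈ S_H} E_μ[log (p_H⁽ˡ⁾(Z_H⁽ˡ⁾ ∣ Z_A⁽ˡ⁾, Z_X⁽ˡ⁾) / q_H⁽ˡ⁾(Z_H⁽ˡ⁾))]`,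
where `p_A⁽ˡ⁾`, `p_H⁽ˡ⁾` are the true conditional pmfs. -/
theorem mlgib_proposition_two_variational {Ω S : Type*} [MeasurableSpace Ω]
    [Fintype S] [MeasurableSpace S] [MeasurableSingletonClass S]
    (μ : Measure Ω) [IsProbabilityMeasure μ]
    (L : ℕ) (A : Ω → S) (ZX ZA ZH : Fin (L + 1) → Ω → S)
    (hA : Measurable A) (hZX : ∀ l, Measurable (ZX l))
    (hZA : ∀ l, Measurable (ZA l)) (hZH : ∀ l, Measurable (ZH l))
    (hMarkovA : ∀ l : Fin (L + 1),
      finCondMutualInfo μ (ZA l)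
        (mlPrefix L A ZX ZA ZH (2 + 3 * l.val) (by omega))
        (fun ω => (A ω, ZX l ω)) = 0)
    (hMarkovH : ∀ l : Fin (L + 1),
      finCondMutualInfo μ (ZH l)
        (mlPrefix L A ZX ZA ZH (3 + 3 * l.val) (by omega))
        (fun ω => (ZA l ω, ZX l ω)) = 0)
    (hMarkovX : ∀ l : Fin (L + 1), ∀ h : l.val < L,
      finCondMutualInfo μ (ZX ⟨l.val + 1, by omega⟩)
        (mlPrefix L A ZX ZA ZH (4 + 3 * l.val) (by omega))
        (fun ω => (ZH l ω, ZA l ω)) = 0)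
    (SH : Finset (Fin (L + 1))) (hSH : SH.Nonempty)
    (SA : Finset (Fin (L + 1)))
    (hSA : SA = Finset.univ.filter (fun l : Fin (L + 1) => SH.max' hSH ≤ l))
    (qA qH : Fin (L + 1) → S → ℝ)
    (hqA_pos : ∀ l ∈ SA, ∀ s, 0 < qA l s) (hqA_sum : ∀ l ∈ SA, ∑ s : S, qA l s = 1)
    (hqH_pos : ∀ l ∈ SH, ∀ s, 0 < qH l s) (hqH_sum : ∀ l ∈ SH, ∑ s : S, qH l s = 1) :
    finMutualInfo μ (fun ω => (A ω, ZX 0 ω)) (ZH (Fin.last L)) ≤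
      (∑ l ∈ SA, ∫ ω, Real.log
          (finCondPMF μ (ZA l) (fun ω' => (A ω', ZX l ω')) (ZA l ω) (A ω, ZX l ω)
            / qA l (ZA l ω)) ∂μ)
        + ∑ l ∈ SH, ∫ ω, Real.log
            (finCondPMF μ (ZH l) (fun ω' => (ZA l ω', ZX l ω')) (ZH l ω) (ZA l ω, ZX l ω)
              / qH l (ZH l ω)) ∂μ := by
  have hD (l : Fin (L + 1)) := finCondMutualInfo_source_eq_zero hA hZX hZA hZH (hZA l)
    (hA.prodMk (hZX l)) (by omega) (hMarkovA l)
  have hDH (l : Fin (L + 1)) := finCondMutualInfo_source_eq_zero hA hZX hZA hZH (hZH l)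
    ((hZA l).prodMk (hZX l)) (by omega) (hMarkovH l)
  have hDX (l : Fin (L + 1)) (h : l.val < L) := finCondMutualInfo_source_eq_zero hA hZX hZA hZH
    (hZX ⟨l.val + 1, by omega⟩) ((hZH l).prodMk (hZA l)) (by omega) (hMarkovX l h)
  set m := SH.max' hSH
  have key : ∀ n (hmn : m.val ≤ n) (hn : n < L + 1),
      finMutualInfo μ (fun ω => (A ω, ZX 0 ω)) (fun ω => (ZH ⟨n, hn⟩ ω, ZA ⟨n, hn⟩ ω))
        ≤ ∑ l ∈ Finset.Icc m ⟨n, hn⟩, finMutualInfo μ (ZA l) (fun ω => (A ω, ZX l ω))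
          + finMutualInfo μ (ZH m) (fun ω => (ZA m ω, ZX m ω)) := by
    intro n hmn
    induction n, hmn using Nat.le_induction with
    | base =>
      intro _
      simpa using finMutualInfo_le_add_of_markov hA (hZX 0) (hZX m) (hZA m) (hZH m) (hD m) (hDH m)
    | succ n hmn ih =>
      intro hn
      have hIcc : Finset.Icc m ⟨n + 1, hn⟩
          = insert ⟨n + 1, hn⟩ (Finset.Icc m ⟨n, by omega⟩) := by
        ext l
        simp only [Finset.mem_Icc, Finset.mem_insert, Fin.le_def, Fin.ext_iff]
        omega
      rw [hIcc, Finset.sum_insert (by simp [Fin.le_def])]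
      have := finMutualInfo_succ_le_of_markov hA (hZX 0) (hZA ⟨n, by omega⟩) (hZH ⟨n, by omega⟩)
        (hZX ⟨n + 1, hn⟩) (hZA ⟨n + 1, hn⟩) (hZH ⟨n + 1, hn⟩)
        (hDX ⟨n, by omega⟩ (by simpa using hn)) (hD _) (hDH _)
      linarith [ih (by omega)]
  have hIcc : Finset.Icc m ⟨L, by omega⟩ = SA := by
    rw [hSA]
    ext l
    simp only [Finset.mem_Icc, Finset.mem_filter, Finset.mem_univ, true_and, Fin.le_def]
    omega
  have hlast := key L (by omega) (by omega)
  rw [hIcc] at hlast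
  refine (finMutualInfo_le_prodMk (hA.prodMk (hZX 0)) (hZH _) (hZA (Fin.last L))).trans
    (hlast.trans (add_le_add (Finset.sum_le_sum fun l hl => ?_) ?_))
  · exact finMutualInfo_le_integral_log_condPMF_div (hZA l) (hA.prodMk (hZX l)) (hqA_pos l hl)
      (hqA_sum l hl)
  · have hH (l) (hl : l ∈ SH) := finMutualInfo_le_integral_log_condPMF_div (μ := μ) (hZH l)
      ((hZA l).prodMk (hZX l)) (hqH_pos l hl) (hqH_sum l hl)
    have hmem : m ∈ SH := SH.max'_mem hSH
    exact (hH m hmem).trans (Finset.single_le_sum (f := fun l => ∫ ω, Real.log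
      (finCondPMF μ (ZH l) (fun ω' => (ZA l ω', ZX l ω')) (ZH l ω) (ZA l ω, ZX l ω)
        / qH l (ZH l ω)) ∂μ) (fun l hl => (finMutualInfo_nonneg (hZH l)
      ((hZA l).prodMk (hZX l))).trans (hH l hl)) hmem)
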